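/- For all f₁, f₂, φ₁, φ₂ ∈ L²(ℝ) and every x₂ ∈ ℝ the orthogonality relation ⟨W_{φ₁}f₁, W_{φ₂}f₂⟩_{x₂} = ⟨f₁,f₂⟩_{L²(ℝ)} · conj(⟨φ₁,φ₂⟩_{L²(ℝ)}) holds. -/

import Mathlib

open MeasureTheory

/-- The induced coherent state transform W_φ f on 𝔾/Z ≃ ℝ³. -/
noncomputable def W (h₂ ℏ : ℝ) (φ f : ℝ → ℂ) (x : ℝ × ℝ × ℝ) : ℂ :=
  Complex.exp (-(2 * Real.pi * Complex.I * h₂ * x.2.1)) *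
    ∫ y : ℝ, f y * Complex.exp (-(2 * Real.pi * Complex.I * ℏ *
      (-(x.2.2 * y) + (1/2) * x.2.1 * y^2))) * star (φ (y - x.1))

open scoped FourierTransform SchwartzMap ContDiff

lemma fourier_ae (g : ℝ → ℂ) (h1 : Integrable g) (h2 : MemLp g 2 (volume : Measure ℝ)) :
    (𝓕 (h2.toLp g) : Lp ℂ 2 (volume : Measure ℝ)) =ᵐ[volume] 𝓕 g := by
  have hc : Continuous (𝓕 g) :=
    VectorFourier.fourierIntegral_continuous Real.continuous_fourierChar
      (by exact continuous_inner) h1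
  refine ae_eq_of_integral_contDiff_smul_eq ((Lp.memLp _).locallyIntegrable (by norm_num))
    hc.locallyIntegrable ?_
  intro u hu hcu
  have hg₁ : HasCompactSupport (Complex.ofRealCLM ∘ u) := hcu.comp_left rfl
  have hg₂ : ContDiff ℝ ∞ (Complex.ofRealCLM ∘ u) := by fun_prop
  have key := congrArg (fun T : 𝓢'(ℝ, ℂ) => T (hg₁.toSchwartzMap hg₂))
    (Lp.fourier_toTemperedDistribution_eq (h2.toLp g))
  simp only [TemperedDistribution.fourier_apply, Lp.toTemperedDistribution_apply] at key
  have e1 : ∫ x, u x • (𝓕 (h2.toLp g) : Lp ℂ 2 (volume : Measure ℝ)) x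
     = ∫ x, (hg₁.toSchwartzMap hg₂) x • (𝓕 (h2.toLp g) : Lp ℂ 2 (volume : Measure ℝ)) x := by
    simp
  rw [e1, ← key]
  have e2 : ∫ x, (𝓕 (hg₁.toSchwartzMap hg₂)) x • (h2.toLp g) x
     = ∫ x, (𝓕 (hg₁.toSchwartzMap hg₂)) x • g x := by
    apply integral_congr_ae
    filter_upwards [h2.coeFn_toLp] with x hx
    rw [hx]
  rw [e2]
  have := VectorFourier.integral_fourierIntegral_smul_eq_flip (L := innerₗ ℝ) (μ := volume) (ν := volume)
    Real.continuous_fourierChar (by exact continuous_inner) (hg₁.toSchwartzMap hg₂).integrable h1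
  rw [flip_innerₗ] at this
  refine Eq.trans this ?_
  apply integral_congr_ae
  filter_upwards with x
  simp
  left; rfl

lemma memLp_fourier (g : ℝ → ℂ) (h1 : Integrable g) (h2 : MemLp g 2 (volume : Measure ℝ)) :
    MemLp (𝓕 g) 2 (volume : Measure ℝ) :=
  (memLp_congr_ae (fourier_ae g h1 h2)).1 (Lp.memLp _)

lemma plancherel (g k : ℝ → ℂ) (h1 : Integrable g) (h2 : MemLp g 2 (volume : Measure ℝ))
    (k1 : Integrable k) (k2 : MemLp k 2 (volume : Measure ℝ)) :
    ∫ w, 𝓕 g w * star (𝓕 k w) = ∫ y, g y * star (k y) := by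
  have := Lp.inner_fourier_eq (k2.toLp k) (h2.toLp g)
  rw [L2.inner_def, L2.inner_def] at this
  have e1 : ∫ w, 𝓕 g w * star (𝓕 k w) = ∫ a, inner ℂ ((𝓕 (k2.toLp k) : Lp ℂ 2 (volume : Measure ℝ)) a) ((𝓕 (h2.toLp g) : Lp ℂ 2 (volume : Measure ℝ)) a) := by
    apply integral_congr_ae
    filter_upwards [fourier_ae g h1 h2, fourier_ae k k1 k2] with x hx hy
    rw [hx, hy]; simp
  have e2 : ∫ w, g w * star (k w) = ∫ a, inner ℂ ((k2.toLp k) a) ((h2.toLp g) a) := by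
    apply integral_congr_ae
    filter_upwards [h2.coeFn_toLp, k2.coeFn_toLp] with x hx hy
    rw [hx, hy]; simp
  rw [e1, e2, this]

lemma plancherel_scaled (ℏ : ℝ) (hℏ : 0 < ℏ) (g k : ℝ → ℂ) (h1 : Integrable g) (h2 : MemLp g 2 (volume : Measure ℝ))
    (k1 : Integrable k) (k2 : MemLp k 2 (volume : Measure ℝ)) :
    (ℏ:ℂ) * ∫ t : ℝ, 𝓕 g (-ℏ * t) * star (𝓕 k (-ℏ * t)) = ∫ y, g y * star (k y) := by
  rw [Measure.integral_comp_mul_left (fun w => 𝓕 g w * star (𝓕 k w)), plancherel g k h1 h2 k1 k2]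
  rw [inv_neg, abs_neg, abs_of_pos (inv_pos.2 hℏ), Complex.real_smul, ← mul_assoc]
  have : (ℏ:ℂ) ≠ 0 := by exact_mod_cast hℏ.ne'
  push_cast
  rw [mul_inv_cancel₀ this, one_mul]

lemma slice_integrable (f φ : ℝ → ℂ) (hf : MemLp f 2 (volume : Measure ℝ))
    (hφ : MemLp φ 2 (volume : Measure ℝ)) (x : ℝ) :
    Integrable (fun y => f y * star (φ (y - x))) := by
  have h : MemLp (fun y => star (φ (y - x))) 2 (volume : Measure ℝ) :=
    (hφ.comp_measurePreserving (measurePreserving_sub_right volume x)).star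
  exact hf.integrable_mul h

lemma prod_integrable (f g : ℝ → ℂ) (hf : Integrable f) (hg : Integrable g) :
    Integrable (fun p : ℝ × ℝ => f p.2 * g (p.2 - p.1)) (volume.prod volume) := by
  have := hf.convolution_integrand (ContinuousLinearMap.mul ℂ ℂ) (hg.comp_neg)
  simpa using this

lemma prod_integral (f g : ℝ → ℂ) (hf : Integrable f) (hg : Integrable g) :
    ∫ x : ℝ, ∫ y : ℝ, f y * g (y - x) = (∫ y, f y) * ∫ y, g y := by
  have := integral_convolution (ContinuousLinearMap.mul ℂ ℂ) hf (hg.comp_neg)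
  simpa [convolution_def, integral_neg_eq_self] using this

lemma slice_memLp (f φ : ℝ → ℂ) (hf : MemLp f 2 (volume : Measure ℝ))
    (hφ : MemLp φ 2 (volume : Measure ℝ)) :
    ∀ᵐ x : ℝ, MemLp (fun y => f y * star (φ (y - x))) 2 (volume : Measure ℝ) := by
  have h := (prod_integrable (fun y => f y * star (f y)) (fun y => star (φ y) * φ y)
    (hf.integrable_mul hf.star) (hφ.star.integrable_mul hφ)).prod_right_ae
  filter_upwards [h] with x hx
  rw [memLp_two_iff_integrable_sq_norm (slice_integrable f φ hf hφ x).1]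
  refine hx.norm.congr ?_
  filter_upwards with y
  simp; ring

lemma four_meas (ℏ : ℝ) (f φ : ℝ → ℂ) (hf : MemLp f 2 (volume : Measure ℝ))
    (hφ : MemLp φ 2 (volume : Measure ℝ)) :
    AEStronglyMeasurable (fun p : ℝ × ℝ => 𝓕 (fun y => f y * star (φ (y - p.1))) (-ℏ * p.2))
      (volume.prod volume) := by
  simp_rw [Real.fourier_real_eq_integral_exp_smul]
  refine AEStronglyMeasurable.integral_prod_right' (f := fun q : (ℝ × ℝ) × ℝ =>
    Complex.exp (↑(-2 * Real.pi * q.2 * (-ℏ * q.1.2)) * Complex.I) • (f q.2 * star (φ (q.2 - q.1.1)))) ?_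
  simp only [smul_eq_mul]
  refine AEStronglyMeasurable.mul ?_ ?_
  · apply Continuous.aestronglyMeasurable
    fun_prop
  · refine hf.1.comp_snd.mul ?_
    have hq : Measure.QuasiMeasurePreserving (fun q : (ℝ × ℝ) × ℝ => q.2 - q.1.1)
      ((volume.prod volume).prod volume) volume := by
      refine QuasiMeasurePreserving.prod_of_right (by fun_prop) ?_
      filter_upwards with x
      exact (measurePreserving_sub_right volume x.1).quasiMeasurePreserving
    exact (hφ.1.comp_quasiMeasurePreserving hq).star

lemma four_memLp (ℏ : ℝ) (hℏ : 0 < ℏ) (f φ : ℝ → ℂ) (hf : MemLp f 2 (volume : Measure ℝ))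
    (hφ : MemLp φ 2 (volume : Measure ℝ)) :
    MemLp (fun p : ℝ × ℝ => 𝓕 (fun y => f y * star (φ (y - p.1))) (-ℏ * p.2)) 2
      (volume.prod volume) := by
  have hm := four_meas ℏ f φ hf hφ
  rw [memLp_two_iff_integrable_sq_norm hm]
  refine (integrable_prod_iff (hm.norm.pow 2)).2 ?_
  simp only [Pi.pow_apply]
  have hs := slice_memLp f φ hf hφ
  constructor
  · filter_upwards [hs] with x hx
    have h := memLp_fourier _ (slice_integrable f φ hf hφ x) hx
    exact Integrable.comp_mul_left' (g := fun w => ‖𝓕 (fun y => f y * star (φ (y - x))) w‖ ^ 2)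
      ((memLp_two_iff_integrable_sq_norm h.1).1 h) (neg_ne_zero.2 hℏ.ne')
  · have h := (prod_integrable (fun y => f y * star (f y)) (fun y => star (φ y) * φ y)
      (hf.integrable_mul hf.star) (hφ.star.integrable_mul hφ)).integral_prod_left
    refine ((h.const_mul (ℏ⁻¹ : ℂ)).norm).congr ?_
    filter_upwards [hs] with x hx
    have hp := plancherel_scaled ℏ hℏ _ _ (slice_integrable f φ hf hφ x) hx
      (slice_integrable f φ hf hφ x) hx
    have hne : (ℏ:ℂ) ≠ 0 := by exact_mod_cast hℏ.ne'
    have e : ∫ y : ℝ, (f y * star (f y)) * (star (φ (y - x)) * φ (y - x))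
        = ∫ y : ℝ, (f y * star (φ (y - x))) * star (f y * star (φ (y - x))) := by
      congr 1; ext y; simp; ring
    rw [e, ← hp, inv_mul_cancel_left₀ hne]
    have e2 : ∀ z : ℂ, z * star z = ((‖z‖ ^ 2 : ℝ) : ℂ) := by
      intro z; simp [Complex.mul_conj']
    simp_rw [e2, integral_complex_ofReal]
    rw [Complex.norm_real, Real.norm_of_nonneg (by positivity)]
    simp

lemma core (ℏ : ℝ) (hℏ : 0 < ℏ) (f₁ f₂ φ₁ φ₂ : ℝ → ℂ)
    (hf₁ : MemLp f₁ 2 (volume : Measure ℝ)) (hf₂ : MemLp f₂ 2 (volume : Measure ℝ))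
    (hφ₁ : MemLp φ₁ 2 (volume : Measure ℝ)) (hφ₂ : MemLp φ₂ 2 (volume : Measure ℝ)) :
    (ℏ : ℂ) * ∫ p : ℝ × ℝ, 𝓕 (fun y => f₁ y * star (φ₁ (y - p.1))) (-ℏ * p.2) *
        star (𝓕 (fun y => f₂ y * star (φ₂ (y - p.1))) (-ℏ * p.2))
      = (∫ y : ℝ, f₁ y * star (f₂ y)) * star (∫ y : ℝ, φ₁ y * star (φ₂ y)) := by
  have hint := (four_memLp ℏ hℏ f₁ φ₁ hf₁ hφ₁).integrable_mul (four_memLp ℏ hℏ f₂ φ₂ hf₂ hφ₂).star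
  have e0 := integral_prod _ hint
  simp only [Pi.mul_apply, Pi.star_apply] at e0
  rw [Measure.volume_eq_prod, e0, ← integral_const_mul]
  have e3 : star (∫ y : ℝ, φ₁ y * star (φ₂ y)) = ∫ y, star (φ₁ y) * φ₂ y := by
    rw [Complex.star_def, ← integral_conj]
    simp
  rw [e3, ← prod_integral (fun y => f₁ y * star (f₂ y)) (fun y => star (φ₁ y) * φ₂ y)
    (hf₁.integrable_mul hf₂.star) (hφ₁.star.integrable_mul hφ₂)]
  apply integral_congr_ae
  filter_upwards [slice_memLp f₁ φ₁ hf₁ hφ₁, slice_memLp f₂ φ₂ hf₂ hφ₂] with x h1 h2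
  rw [plancherel_scaled ℏ hℏ _ _ (slice_integrable f₁ φ₁ hf₁ hφ₁ x) h1
    (slice_integrable f₂ φ₂ hf₂ hφ₂ x) h2]
  congr 1; ext y; simp; ring

/-- The unimodular chirp. -/
noncomputable def chirp (ℏ x₂ y : ℝ) : ℂ := Complex.exp ((-(Real.pi * ℏ * x₂ * y ^ 2) : ℝ) * Complex.I)

lemma chirp_star (ℏ x₂ y : ℝ) : chirp ℏ x₂ y * star (chirp ℏ x₂ y) = 1 := by
  have : ‖chirp ℏ x₂ y‖ = 1 := Complex.norm_exp_ofReal_mul_I _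
  simp [Complex.mul_conj', this]

lemma chirp_memLp (ℏ x₂ : ℝ) (f : ℝ → ℂ) (hf : MemLp f 2 (volume : Measure ℝ)) :
    MemLp (fun y => f y * chirp ℏ x₂ y) 2 (volume : Measure ℝ) := by
  refine hf.of_le (hf.1.mul (Continuous.aestronglyMeasurable (by unfold chirp; fun_prop))) ?_
  filter_upwards with y
  have : ‖chirp ℏ x₂ y‖ = 1 := Complex.norm_exp_ofReal_mul_I _
  simp [this]

lemma W_eq (h₂ ℏ : ℝ) (φ f : ℝ → ℂ) (x x₂ t : ℝ) :
    W h₂ ℏ φ f (x, x₂, t) = Complex.exp ((-(2 * Real.pi * h₂ * x₂) : ℝ) * Complex.I) *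
      𝓕 (fun y => (f y * chirp ℏ x₂ y) * star (φ (y - x))) (-ℏ * t) := by
  rw [Real.fourier_real_eq_integral_exp_smul]
  unfold W chirp
  congr 1
  · congr 1; push_cast; ring
  · congr 1; ext y
    simp only [smul_eq_mul]
    rw [show (-(2 * Real.pi * Complex.I * ℏ * (-(t * y) + (1/2) * x₂ * y^2)) : ℂ)
      = (↑(-2 * Real.pi * y * (-ℏ * t)) * Complex.I) + ((-(Real.pi * ℏ * x₂ * y ^ 2) : ℝ) * Complex.I)
      by push_cast; ring, Complex.exp_add]
    ring

theorem stmt5 (h₂ ℏ : ℝ) (hℏ : 0 < ℏ) (f₁ f₂ φ₁ φ₂ : ℝ → ℂ)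
    (hf₁ : MemLp f₁ 2 (volume : Measure ℝ)) (hf₂ : MemLp f₂ 2 (volume : Measure ℝ))
    (hφ₁ : MemLp φ₁ 2 (volume : Measure ℝ)) (hφ₂ : MemLp φ₂ 2 (volume : Measure ℝ))
    (x₂ : ℝ) :
    (ℏ : ℂ) * ∫ p : ℝ × ℝ, W h₂ ℏ φ₁ f₁ (p.1, x₂, p.2) * star (W h₂ ℏ φ₂ f₂ (p.1, x₂, p.2))
      = (∫ y : ℝ, f₁ y * star (f₂ y)) * star (∫ y : ℝ, φ₁ y * star (φ₂ y)) := by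
  have h := core ℏ hℏ _ _ φ₁ φ₂ (chirp_memLp ℏ x₂ f₁ hf₁) (chirp_memLp ℏ x₂ f₂ hf₂) hφ₁ hφ₂
  have e1 : ∀ y, f₁ y * chirp ℏ x₂ y * star (f₂ y * chirp ℏ x₂ y) = f₁ y * star (f₂ y) := by
    intro y
    rw [star_mul', mul_mul_mul_comm, chirp_star, mul_one]
  simp_rw [e1] at h
  rw [← h]
  congr 2; ext p
  rw [W_eq, W_eq, star_mul', mul_mul_mul_comm]
  have : ‖Complex.exp ((-(2 * Real.pi * h₂ * x₂) : ℝ) * Complex.I)‖ = 1 :=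
    Complex.norm_exp_ofReal_mul_I _
  rw [Complex.star_def, Complex.mul_conj', this]
  simp
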